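/- Let n ≥ 3 be an integer, m = (n−2)/(n+2), β > 0, and γ = (2β+1)/(1−m) (shrinker case ρ = 1). Then for every λ > 0 there exists a positive smooth radially symmetric function u on ℝⁿ with u(0) = λ solving ((n−1)/m)·Δ(u^m) + β·(x·∇u) + γ·u = 0 on all of ℝⁿ, and there exists a constant C > 0 such that u(x) ≤ C·|x|^{−2/(1−m)} for all |x| ≥ 1 (the cigar solutions, of slow-decay rate at infinity). -/

import Mathlib

open Real MeasureTheory Metric
open scoped Topology RealInnerProductSpace

noncomputable section

/-- Euclidean space ℝⁿ. -/
abbrev Euc (n : ℕ) := EuclideanSpace ℝ (Fin n)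

/-- Euclidean Laplacian: sum of pure second derivatives in the coordinate directions. -/
def lap {n : ℕ} (f : Euc n → ℝ) (x : Euc n) : ℝ :=
  ∑ i : Fin n, fderiv ℝ (fun y => fderiv ℝ f y (EuclideanSpace.single i 1)) x
    (EuclideanSpace.single i 1)

/-- The conformally flat Yamabe soliton equation
`((n-1)/m)·Δ(u^m) + β·(x·∇u) + γ·u = 0` on ℝⁿ. -/
def YamabePDE {n : ℕ} (m β γ : ℝ) (u : Euc n → ℝ) : Prop :=
  ∀ x : Euc n, ((n : ℝ) - 1) / m * lap (fun y => u y ^ m) x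
      + β * ⟪x, gradient u x⟫ + γ * u x = 0

/-- A function on ℝⁿ is radially symmetric if it depends only on the norm. -/
def IsRadial {n : ℕ} (u : Euc n → ℝ) : Prop :=
  ∀ x y : Euc n, ‖x‖ = ‖y‖ → u x = u y

/-- Scalar curvature of the conformally flat metric g = u^{4/(n+2)}·dx²:
`R = -(4(n-1)/(n-2))·u⁻¹·Δ(u^m)`. -/
def scalarCurv {n : ℕ} (m : ℝ) (u : Euc n → ℝ) (x : Euc n) : ℝ :=
  -(4 * ((n : ℝ) - 1) / ((n : ℝ) - 2)) * lap (fun y => u y ^ m) x / u x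

/-- The weighted radial average `s ↦ ∫₀¹ θᵏ h(s θ²) dθ`. -/
def radialAvg (k : ℕ) (h : ℝ → ℝ) (s : ℝ) : ℝ :=
  ∫ θ in (0 : ℝ)..1, θ ^ k * h (s * θ ^ 2)

lemma mul_sq_mem_Icc {a b s θ : ℝ} (ha : a ≤ 0) (hb : 0 ≤ b) (hs : s ∈ Set.Icc a b)
    (hθ : θ ∈ Set.Icc (0 : ℝ) 1) : s * θ ^ 2 ∈ Set.Icc a b := by
  obtain ⟨h1, h2⟩ := hs
  obtain ⟨h3, h4⟩ := hθ
  have h5 : θ ^ 2 ≤ 1 := by nlinarith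
  have h6 : 0 ≤ θ ^ 2 := sq_nonneg θ
  constructor <;> nlinarith

lemma mul_sq_mem_Ioo {a b s θ : ℝ} (ha : a < 0) (hb : 0 < b) (hs : s ∈ Set.Ioo a b)
    (hθ : θ ∈ Set.Icc (0 : ℝ) 1) : s * θ ^ 2 ∈ Set.Ioo a b := by
  obtain ⟨h1, h2⟩ := hs
  obtain ⟨h3, h4⟩ := hθ
  have h5 : θ ^ 2 ≤ 1 := by nlinarith
  have h6 : 0 ≤ θ ^ 2 := sq_nonneg θ
  constructor
  · rcases le_total s 0 with h | h <;> nlinarith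
  · rcases le_total s 0 with h | h <;> nlinarith

lemma exists_Icc_subset_Ioo {α β s : ℝ} (hα : α < 0) (hβ : 0 < β) (hs : s ∈ Set.Ioo α β) :
    ∃ a b, a < 0 ∧ 0 < b ∧ s ∈ Set.Ioo a b ∧ Set.Icc a b ⊆ Set.Ioo α β := by
  obtain ⟨a, ha1, ha2⟩ := exists_between (lt_min hα hs.1)
  obtain ⟨b, hb1, hb2⟩ := exists_between (max_lt hβ hs.2)
  exact ⟨a, b, lt_of_lt_of_le ha2 (min_le_left _ _), lt_of_le_of_lt (le_max_left _ _) hb1,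
    ⟨lt_of_lt_of_le ha2 (min_le_right _ _), lt_of_le_of_lt (le_max_right _ _) hb1⟩,
    fun x hx => ⟨ha1.trans_le hx.1, hx.2.trans_lt hb2⟩⟩

lemma continuous_radialAvg (k : ℕ) {h : ℝ → ℝ} (hh : Continuous h) :
    Continuous (radialAvg k h) := by
  unfold radialAvg
  apply intervalIntegral.continuous_parametric_intervalIntegral_of_continuous'
  simp only [Function.uncurry_def]
  fun_prop

lemma continuousOn_radialAvg (k : ℕ) {h : ℝ → ℝ} {α β : ℝ} (hα : α < 0) (hβ : 0 < β)
    (hh : ContinuousOn h (Set.Ioo α β)) : ContinuousOn (radialAvg k h) (Set.Ioo α β) := by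
  intro s hs
  obtain ⟨a, b, ha, hb, hsab, hsub⟩ := exists_Icc_subset_Ioo hα hβ hs
  have hab : a ≤ b := (ha.trans hb).le
  have hc : Continuous (Set.IccExtend hab ((Set.Icc a b).domRestrict h)) :=
    (continuousOn_iff_continuous_domRestrict.1 (hh.mono hsub)).Icc_extend'
  apply ContinuousAt.continuousWithinAt
  apply (continuous_radialAvg k hc).continuousAt.congr
  filter_upwards [isOpen_Ioo.mem_nhds hsab] with x hx
  unfold radialAvg
  apply intervalIntegral.integral_congr
  intro θ hθ
  rw [Set.uIcc_of_le zero_le_one] at hθ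
  have := mul_sq_mem_Icc ha.le hb.le (Set.Ioo_subset_Icc_self hx) hθ
  simp only [Set.IccExtend_of_mem hab _ this, Set.domRestrict_apply]

lemma hasDerivAt_radialAvg (k : ℕ) {h h' : ℝ → ℝ} {α β : ℝ} (hα : α < 0) (hβ : 0 < β)
    (hh : ∀ s ∈ Set.Ioo α β, HasDerivAt h (h' s) s) (hh' : ContinuousOn h' (Set.Ioo α β))
    {s : ℝ} (hs : s ∈ Set.Ioo α β) :
    HasDerivAt (radialAvg k h) (radialAvg (k + 2) h' s) s := by
  obtain ⟨a, b, ha, hb, hsab, hsub⟩ := exists_Icc_subset_Ioo hα hβ hs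
  obtain ⟨C, hC⟩ := isCompact_Icc.exists_bound_of_continuousOn (hh'.mono hsub)
  have hcont : ContinuousOn h (Set.Ioo α β) := fun x hx => (hh x hx).continuousAt.continuousWithinAt
  have hI : ∀ (j : ℕ) (f : ℝ → ℝ), ContinuousOn f (Set.Ioo α β) → ∀ x ∈ Set.Ioo a b,
      ContinuousOn (fun θ : ℝ => θ ^ j * f (x * θ ^ 2)) (Set.uIcc 0 1) := by
    intro j f hf x hx
    refine ContinuousOn.mul (by fun_prop) (hf.comp (by fun_prop) ?_)
    intro θ hθ
    rw [Set.uIcc_of_le zero_le_one] at hθ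
    exact hsub (mul_sq_mem_Icc ha.le hb.le (Set.Ioo_subset_Icc_self hx) hθ)
  refine (intervalIntegral.hasDerivAt_integral_of_dominated_loc_of_deriv_le
    (F := fun x θ => θ ^ k * h (x * θ ^ 2)) (F' := fun x θ => θ ^ (k + 2) * h' (x * θ ^ 2))
    (bound := fun _ => C) (s := Set.Ioo a b) (isOpen_Ioo.mem_nhds hsab) ?_ ?_ ?_ ?_ ?_ ?_).2
  · filter_upwards [isOpen_Ioo.mem_nhds hsab] with x hx
    exact ((hI k h hcont x hx).intervalIntegrable (μ := volume)).def'.aestronglyMeasurable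
  · exact (hI k h hcont s hsab).intervalIntegrable
  · exact ((hI (k + 2) h' hh' s hsab).intervalIntegrable (μ := volume)).def'.aestronglyMeasurable
  · refine Filter.Eventually.of_forall fun θ hθ x hx => ?_
    rw [Set.uIoc_of_le zero_le_one] at hθ
    have hm := mul_sq_mem_Icc ha.le hb.le (Set.Ioo_subset_Icc_self hx) (Set.Ioc_subset_Icc_self hθ)
    rw [norm_mul]
    have h1 : ‖θ ^ (k + 2)‖ ≤ 1 := by
      rw [norm_pow, Real.norm_of_nonneg hθ.1.le]
      exact pow_le_one₀ hθ.1.le hθ.2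
    exact (mul_le_of_le_one_left (norm_nonneg _) h1).trans (hC _ hm)
  · exact intervalIntegrable_const
  · refine Filter.Eventually.of_forall fun θ hθ x hx => ?_
    rw [Set.uIoc_of_le zero_le_one] at hθ
    have hm := mul_sq_mem_Icc ha.le hb.le (Set.Ioo_subset_Icc_self hx) (Set.Ioc_subset_Icc_self hθ)
    have h1 : HasDerivAt (fun x : ℝ => x * θ ^ 2) (θ ^ 2) x := by
      simpa using (hasDerivAt_id x).mul_const (θ ^ 2)
    have h2 := ((hh _ (hsub hm)).comp x h1).const_mul (θ ^ k)
    refine h2.congr_deriv ?_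
    ring

lemma contDiffOn_radialAvg {α β : ℝ} (hα : α < 0) (hβ : 0 < β) (j : ℕ) :
    ∀ (k : ℕ) (h : ℝ → ℝ), ContDiffOn ℝ j h (Set.Ioo α β) →
      ContDiffOn ℝ j (radialAvg k h) (Set.Ioo α β) := by
  induction j with
  | zero =>
    intro k h hh
    simp only [Nat.cast_zero, contDiffOn_zero] at hh ⊢
    exact continuousOn_radialAvg k hα hβ hh
  | succ j ih =>
    intro k h hh
    push_cast at hh ⊢
    rw [contDiffOn_succ_iff_deriv_of_isOpen isOpen_Ioo] at hh ⊢
    obtain ⟨h1, -, h3⟩ := hh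
    have hd : ∀ s ∈ Set.Ioo α β, HasDerivAt (radialAvg k h) (radialAvg (k + 2) (deriv h) s) s :=
      fun s hs => hasDerivAt_radialAvg k hα hβ
        (fun t ht => (h1.differentiableAt (isOpen_Ioo.mem_nhds ht)).hasDerivAt) h3.continuousOn hs
    refine ⟨fun s hs => (hd s hs).differentiableAt.differentiableWithinAt, by simp, ?_⟩
    exact (ih (k + 2) (deriv h) h3).congr fun s hs => (hd s hs).deriv

lemma mul_radialAvg_deriv (k : ℕ) {h h' : ℝ → ℝ} {α β : ℝ} (hα : α < 0) (hβ : 0 < β)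
    (hh : ∀ s ∈ Set.Ioo α β, HasDerivAt h (h' s) s) (hh' : ContinuousOn h' (Set.Ioo α β))
    {s : ℝ} (hs : s ∈ Set.Ioo α β) :
    2 * s * radialAvg (k + 2) h' s = h s - (k + 1) * radialAvg k h s := by
  have hmem : ∀ θ ∈ Set.uIcc (0 : ℝ) 1, s * θ ^ 2 ∈ Set.Ioo α β := by
    intro θ hθ
    rw [Set.uIcc_of_le zero_le_one] at hθ
    exact mul_sq_mem_Ioo hα hβ hs hθ
  have hcont : ContinuousOn h (Set.Ioo α β) := fun x hx => (hh x hx).continuousAt.continuousWithinAt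
  have hI : ∀ (j : ℕ) (f : ℝ → ℝ), ContinuousOn f (Set.Ioo α β) →
      IntervalIntegrable (fun θ : ℝ => θ ^ j * f (s * θ ^ 2)) volume 0 1 := fun j f hf =>
    ContinuousOn.intervalIntegrable
      (ContinuousOn.mul (by fun_prop) (hf.comp (by fun_prop) fun θ hθ => hmem θ hθ))
  have hd : ∀ θ ∈ Set.uIcc (0 : ℝ) 1, HasDerivAt (fun θ : ℝ => θ ^ (k + 1) * h (s * θ ^ 2))
      ((k + 1) * (θ ^ k * h (s * θ ^ 2)) + 2 * s * (θ ^ (k + 2) * h' (s * θ ^ 2))) θ := by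
    intro θ hθ
    have h1 : HasDerivAt (fun θ : ℝ => s * θ ^ 2) (s * (2 * θ)) θ := by
      simpa using (hasDerivAt_pow 2 θ).const_mul s
    refine ((hasDerivAt_pow (k + 1) θ).mul ((hh _ (hmem θ hθ)).comp θ h1)).congr_deriv ?_
    simp only [Function.comp, Nat.add_sub_cancel]
    push_cast
    ring
  have h2 := intervalIntegral.integral_eq_sub_of_hasDerivAt hd
    (((hI k h hcont).const_mul _).add ((hI (k + 2) h' hh').const_mul _))
  rw [intervalIntegral.integral_add ((hI k h hcont).const_mul _) ((hI (k + 2) h' hh').const_mul _),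
    intervalIntegral.integral_const_mul, intervalIntegral.integral_const_mul] at h2
  simp at h2
  unfold radialAvg
  linarith

/-- Right-hand side of the nonlocal first-order equation solved by radial profiles. -/
def profileRHS (H : ℝ → ℝ) (k : ℕ) (k₁ k₂ : ℝ) (g : ℝ → ℝ) (s : ℝ) : ℝ :=
  k₁ * H (g s) + k₂ * radialAvg k (fun t => H (g t)) s

lemma continuous_profileRHS {H g : ℝ → ℝ} (hH : Continuous H) (hg : Continuous g) (k : ℕ)
    (k₁ k₂ : ℝ) : Continuous (profileRHS H k k₁ k₂ g) := by
  have := continuous_radialAvg k (hH.comp hg)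
  unfold profileRHS
  exact ((hH.comp hg).const_mul k₁).add (this.const_mul k₂)

lemma abs_radialAvg_le (k : ℕ) {f : ℝ → ℝ} {s C : ℝ}
    (hf : ∀ θ ∈ Set.Icc (0 : ℝ) 1, |f (s * θ ^ 2)| ≤ C) : |radialAvg k f s| ≤ C := by
  have := intervalIntegral.norm_integral_le_of_norm_le_const (a := 0) (b := 1) (C := C)
    (f := fun θ : ℝ => θ ^ k * f (s * θ ^ 2)) ?_
  · simpa [radialAvg] using this
  · intro θ hθ
    rw [Set.uIoc_of_le zero_le_one] at hθ
    rw [norm_mul, norm_pow, Real.norm_of_nonneg hθ.1.le]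
    exact (mul_le_of_le_one_left (norm_nonneg _) (pow_le_one₀ hθ.1.le hθ.2)).trans
      (hf θ (Set.Ioc_subset_Icc_self hθ))

lemma abs_profileRHS_sub_le {H : ℝ → ℝ} {K : ℝ} (hH : Continuous H) (hK : 0 ≤ K)
    (hL : ∀ x y, |H x - H y| ≤ K * |x - y|) (k : ℕ) (k₁ k₂ : ℝ) {g₁ g₂ : ℝ → ℝ}
    (h₁ : Continuous g₁) (h₂ : Continuous g₂) {d L : ℝ} (hd : 0 ≤ d) (hL0 : 0 ≤ L)
    (h : ∀ t, |g₁ t - g₂ t| ≤ d * rexp (L * |t|)) (s : ℝ) :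
    |profileRHS H k k₁ k₂ g₁ s - profileRHS H k k₁ k₂ g₂ s|
      ≤ (|k₁| + |k₂|) * K * d * rexp (L * |s|) := by
  have hdiff : ∀ t, |t| ≤ |s| → |H (g₁ t) - H (g₂ t)| ≤ K * d * rexp (L * |s|) := by
    intro t ht
    have h3 : rexp (L * |t|) ≤ rexp (L * |s|) :=
      Real.exp_le_exp.2 (mul_le_mul_of_nonneg_left ht hL0)
    calc |H (g₁ t) - H (g₂ t)| ≤ K * |g₁ t - g₂ t| := hL _ _
      _ ≤ K * (d * rexp (L * |s|)) := by
        refine mul_le_mul_of_nonneg_left ((h t).trans ?_) hK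
        exact mul_le_mul_of_nonneg_left h3 hd
      _ = _ := by ring
  have hint : ∀ g : ℝ → ℝ, Continuous g →
      IntervalIntegrable (fun θ : ℝ => θ ^ k * H (g (s * θ ^ 2))) volume 0 1 := by
    intro g hg
    apply Continuous.intervalIntegrable
    fun_prop
  have hsub : radialAvg k (fun t => H (g₁ t)) s - radialAvg k (fun t => H (g₂ t)) s
      = radialAvg k (fun t => H (g₁ t) - H (g₂ t)) s := by
    unfold radialAvg
    rw [← intervalIntegral.integral_sub (hint g₁ h₁) (hint g₂ h₂)]
    simp only [mul_sub]
  have hA : |radialAvg k (fun t => H (g₁ t) - H (g₂ t)) s| ≤ K * d * rexp (L * |s|) := by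
    apply abs_radialAvg_le
    intro θ hθ
    apply hdiff
    rw [abs_mul, abs_of_nonneg (sq_nonneg θ)]
    exact mul_le_of_le_one_right (abs_nonneg _) (pow_le_one₀ hθ.1 hθ.2)
  have e : profileRHS H k k₁ k₂ g₁ s - profileRHS H k k₁ k₂ g₂ s
      = k₁ * (H (g₁ s) - H (g₂ s)) + k₂ * radialAvg k (fun t => H (g₁ t) - H (g₂ t)) s := by
    rw [← hsub]; unfold profileRHS; ring
  rw [e]
  calc _ ≤ |k₁| * |H (g₁ s) - H (g₂ s)| + |k₂| * |radialAvg k (fun t => H (g₁ t) - H (g₂ t)) s| := by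
        rw [← abs_mul, ← abs_mul]; exact abs_add_le _ _
    _ ≤ |k₁| * (K * d * rexp (L * |s|)) + |k₂| * (K * d * rexp (L * |s|)) := by
        gcongr
        exact hdiff s le_rfl
    _ = _ := by ring

lemma abs_profileRHS_le {H : ℝ → ℝ} {B : ℝ} (hB : ∀ x, |H x| ≤ B) (k : ℕ) (k₁ k₂ : ℝ)
    (g : ℝ → ℝ) (s : ℝ) : |profileRHS H k k₁ k₂ g s| ≤ (|k₁| + |k₂|) * B := by
  have hA : |radialAvg k (fun t => H (g t)) s| ≤ B := abs_radialAvg_le k fun θ _ => hB _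
  unfold profileRHS
  calc _ ≤ |k₁| * |H (g s)| + |k₂| * |radialAvg k (fun t => H (g t)) s| := by
        rw [← abs_mul, ← abs_mul]; exact abs_add_le _ _
    _ ≤ |k₁| * B + |k₂| * B := by
        gcongr
        exact hB _
    _ = _ := by ring

lemma abs_integral_le_of_exp_bound {f : ℝ → ℝ} {C L : ℝ} (hC : 0 ≤ C) (hL : 0 < L)
    (hf : ∀ t, |f t| ≤ C * rexp (L * |t|)) (s : ℝ) :
    |∫ t in (0 : ℝ)..s, f t| ≤ C / L * rexp (L * |s|) := by
  have key : ∀ (f : ℝ → ℝ), (∀ t, |f t| ≤ C * rexp (L * |t|)) → ∀ s, 0 ≤ s →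
      |∫ t in (0 : ℝ)..s, f t| ≤ C / L * rexp (L * s) := by
    intro f hf s hs
    have hd : ∀ t ∈ Set.uIcc 0 s, HasDerivAt (fun t => C / L * rexp (L * t)) (C * rexp (L * t)) t := by
      intro t _
      have h1 : HasDerivAt (fun t : ℝ => L * t) L t := by
        simpa using (hasDerivAt_id t).const_mul L
      refine ((h1.exp).const_mul (C / L)).congr_deriv ?_
      field_simp
    have hi : IntervalIntegrable (fun t => C * rexp (L * t)) volume 0 s := by
      apply Continuous.intervalIntegrable
      fun_prop
    have h2 : ‖∫ t in (0 : ℝ)..s, f t‖ ≤ ∫ t in (0 : ℝ)..s, C * rexp (L * t) := by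
      refine intervalIntegral.norm_integral_le_of_norm_le hs
        (Filter.Eventually.of_forall fun t ht => ?_) hi
      simpa [abs_of_pos ht.1] using hf t
    rw [intervalIntegral.integral_eq_sub_of_hasDerivAt hd hi] at h2
    have h3 : 0 ≤ C / L * rexp (L * 0) := by positivity
    rw [Real.norm_eq_abs] at h2
    linarith
  rcases le_total 0 s with hs | hs
  · rw [abs_of_nonneg hs]
    exact key f hf s hs
  · have h1 := key (fun t => f (-t)) (fun t => by simpa using hf (-t)) (-s) (by linarith)
    rw [intervalIntegral.integral_comp_neg, neg_neg, neg_zero, intervalIntegral.integral_symm,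
      abs_neg] at h1
    rwa [abs_of_nonpos hs]

lemma exists_profile {H : ℝ → ℝ} {K B : ℝ} (hH : Continuous H) (hK : 0 ≤ K)
    (hL : ∀ x y, |H x - H y| ≤ K * |x - y|) (hB : ∀ x, |H x| ≤ B) (k : ℕ) (k₁ k₂ a : ℝ) :
    ∃ g : ℝ → ℝ, g 0 = a ∧ ∀ s, HasDerivAt g (profileRHS H k k₁ k₂ g s) s := by
  set D : ℝ := (|k₁| + |k₂|) * K with hD
  have hD0 : 0 ≤ D := by positivity
  set L : ℝ := 2 * D + 1 with hLdef
  have hL1 : 1 ≤ L := by linarith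
  have hB0 : 0 ≤ B := (abs_nonneg _).trans (hB 0)
  let G : BoundedContinuousFunction ℝ ℝ → ℝ → ℝ := fun y s => rexp (L * |s|) * y s
  have hG : ∀ y, Continuous (G y) := fun y => by
    have := y.continuous
    fun_prop
  have hR : ∀ y, Continuous (profileRHS H k k₁ k₂ (G y)) := fun y =>
    continuous_profileRHS hH (hG y) k k₁ k₂
  let F : BoundedContinuousFunction ℝ ℝ → ℝ → ℝ := fun y s =>
    rexp (-(L * |s|)) * (a + ∫ t in (0 : ℝ)..s, profileRHS H k k₁ k₂ (G y) t)
  have hFc : ∀ y, Continuous (F y) := fun y => by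
    have : Continuous fun s => ∫ t in (0 : ℝ)..s, profileRHS H k k₁ k₂ (G y) t :=
      intervalIntegral.continuous_primitive (fun _ _ => (hR y).intervalIntegrable _ _) 0
    fun_prop
  have hFb : ∀ y s, ‖F y s‖ ≤ |a| + (|k₁| + |k₂|) * B := by
    intro y s
    have h1 : ‖∫ t in (0 : ℝ)..s, profileRHS H k k₁ k₂ (G y) t‖ ≤ (|k₁| + |k₂|) * B * |s - 0| :=
      intervalIntegral.norm_integral_le_of_norm_le_const fun t _ =>
        abs_profileRHS_le hB k k₁ k₂ (G y) t
    rw [sub_zero] at h1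
    have h2 : |s| ≤ rexp (L * |s|) := by
      have := Real.add_one_le_exp (L * |s|)
      nlinarith [abs_nonneg s]
    have h3 : 1 ≤ rexp (L * |s|) := Real.one_le_exp (by positivity)
    rw [norm_mul, Real.norm_of_nonneg (Real.exp_pos _).le, Real.exp_neg,
      inv_mul_le_iff₀ (Real.exp_pos _)]
    calc _ ≤ ‖a‖ + ‖∫ t in (0 : ℝ)..s, profileRHS H k k₁ k₂ (G y) t‖ := norm_add_le _ _
      _ ≤ |a| * rexp (L * |s|) + (|k₁| + |k₂|) * B * rexp (L * |s|) := by
        refine add_le_add ?_ (h1.trans ?_)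
        · exact le_mul_of_one_le_right (abs_nonneg _) h3
        · gcongr
      _ = _ := by ring
  let T : BoundedContinuousFunction ℝ ℝ → BoundedContinuousFunction ℝ ℝ := fun y =>
    BoundedContinuousFunction.ofNormedAddCommGroup (F y) (hFc y) _ (hFb y)
  have hT : ContractingWith (1 / 2) T := by
    refine ⟨by norm_num, LipschitzWith.of_dist_le_mul fun y z => ?_⟩
    rw [BoundedContinuousFunction.dist_le (by positivity)]
    intro s
    have hyz : ∀ t, |G y t - G z t| ≤ dist y z * rexp (L * |t|) := by
      intro t
      have h1 : |y t - z t| ≤ dist y z := by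
        rw [← Real.dist_eq]
        exact BoundedContinuousFunction.dist_coe_le_dist t
      have h2 : G y t - G z t = (y t - z t) * rexp (L * |t|) := by
        simp only [G]; ring
      rw [h2, abs_mul, abs_of_pos (Real.exp_pos _)]
      gcongr
    have h1 := abs_integral_le_of_exp_bound (mul_nonneg hD0 dist_nonneg) (by linarith : 0 < L)
      (abs_profileRHS_sub_le hH hK hL k k₁ k₂ (hG y) (hG z) dist_nonneg (by linarith) hyz) s
    rw [intervalIntegral.integral_sub ((hR y).intervalIntegrable _ _)
      ((hR z).intervalIntegrable _ _)] at h1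
    have h2 : T y s - T z s = rexp (-(L * |s|)) *
        ((∫ t in (0 : ℝ)..s, profileRHS H k k₁ k₂ (G y) t)
          - ∫ t in (0 : ℝ)..s, profileRHS H k k₁ k₂ (G z) t) := by
      simp only [T, BoundedContinuousFunction.coe_ofNormedAddCommGroup, F]; ring
    rw [Real.dist_eq, h2, abs_mul, abs_of_pos (Real.exp_pos _), Real.exp_neg,
      inv_mul_le_iff₀ (Real.exp_pos _)]
    refine h1.trans ?_
    rw [mul_comm]
    refine mul_le_mul_of_nonneg_left ?_ (Real.exp_pos _).le
    rw [div_le_iff₀ (by linarith)]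
    have : (0 : ℝ) ≤ dist y z := dist_nonneg
    simp only [NNReal.coe_div, NNReal.coe_one, NNReal.coe_ofNat]
    nlinarith
  let y := hT.fixedPoint T
  have hy : T y = y := hT.fixedPoint_isFixedPt
  have hGy : ∀ s, G y s = a + ∫ t in (0 : ℝ)..s, profileRHS H k k₁ k₂ (G y) t := by
    intro s
    have h1 : y s = F y s := by
      conv_lhs => rw [← hy]
      rfl
    have h2 : G y s = rexp (L * |s|) * F y s := by rw [← h1]
    rw [h2]
    simp only [F]
    rw [← mul_assoc, ← Real.exp_add]
    simp
  refine ⟨G y, by rw [hGy]; simp, fun s => ?_⟩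
  have h1 := (intervalIntegral.integral_hasDerivAt_right ((hR y).intervalIntegrable 0 s)
    ((hR y).stronglyMeasurableAtFilter _ _) (hR y).continuousAt).const_add a
  refine h1.congr_of_eventuallyEq (Filter.Eventually.of_forall hGy)

/-- The power `x ↦ xᵖ` truncated to the interval `[0, M]`. -/
def truncPow (M p x : ℝ) : ℝ := max 0 (min x M) ^ p

lemma truncPow_of_mem {M p x : ℝ} (h0 : 0 ≤ x) (hM : x ≤ M) : truncPow M p x = x ^ p := by
  rw [truncPow, min_eq_left hM, max_eq_right h0]

lemma abs_truncPow_sub_le {M p : ℝ} (hM : 0 ≤ M) (hp : 1 ≤ p) (x y : ℝ) :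
    |truncPow M p x - truncPow M p y| ≤ p * M ^ (p - 1) * |x - y| := by
  have hmem : ∀ x, max 0 (min x M) ∈ Set.Icc 0 M := fun x =>
    ⟨le_max_left _ _, max_le hM (min_le_right _ _)⟩
  have h1 := (convex_Icc 0 M).norm_image_sub_le_of_norm_hasDerivWithin_le
    (f := fun x : ℝ => x ^ p) (f' := fun x => p * x ^ (p - 1)) (C := p * M ^ (p - 1))
    (fun x _ => (Real.hasDerivAt_rpow_const (Or.inr hp)).hasDerivWithinAt)
    (fun x hx => by
      have h2 : 0 ≤ x ^ (p - 1) := Real.rpow_nonneg hx.1 _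
      rw [Real.norm_of_nonneg (by positivity)]
      exact mul_le_mul_of_nonneg_left (Real.rpow_le_rpow hx.1 hx.2 (by linarith)) (by linarith))
    (hmem y) (hmem x)
  refine h1.trans (mul_le_mul_of_nonneg_left ?_ ?_)
  · refine (abs_max_sub_max_le_max (0 : ℝ) (min x M) 0 (min y M)).trans ?_
    refine max_le (by simp) ((abs_min_sub_min_le_max x M y M).trans ?_)
    simp
  · have := Real.rpow_nonneg hM (p - 1)
    positivity

lemma abs_truncPow_le {M p : ℝ} (hM : 0 ≤ M) (hp : 0 ≤ p) (x : ℝ) : |truncPow M p x| ≤ M ^ p := by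
  have h0 : 0 ≤ max 0 (min x M) := le_max_left _ _
  rw [truncPow, abs_of_nonneg (Real.rpow_nonneg h0 _)]
  exact Real.rpow_le_rpow h0 (max_le hM (min_le_right _ _)) hp

lemma continuous_truncPow {M p : ℝ} (hp : 0 ≤ p) : Continuous (truncPow M p) := by
  unfold truncPow
  exact Continuous.rpow_const (by fun_prop) fun _ => Or.inr hp

section Profile

variable {M p k₁ k₂ : ℝ} {k : ℕ} {g : ℝ → ℝ}

lemma continuous_of_profile (hg : ∀ s, HasDerivAt g (profileRHS (truncPow M p) k k₁ k₂ g s) s) :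
    Continuous g :=
  continuous_iff_continuousAt.2 fun s => (hg s).continuousAt

lemma continuous_deriv_of_profile (hp : 0 ≤ p)
    (hg : ∀ s, HasDerivAt g (profileRHS (truncPow M p) k k₁ k₂ g s) s) :
    Continuous (deriv g) := by
  have : deriv g = profileRHS (truncPow M p) k k₁ k₂ g := funext fun s => (hg s).deriv
  rw [this]
  exact continuous_profileRHS (continuous_truncPow hp) (continuous_of_profile hg) k k₁ k₂

lemma contDiffOn_profile {α ω : ℝ} (hα : α < 0) (hω : 0 < ω)
    (hg : ∀ s, HasDerivAt g (profileRHS (truncPow M p) k k₁ k₂ g s) s)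
    (hI : ∀ s ∈ Set.Ioo α ω, 0 < g s ∧ g s < M) (j : ℕ) : ContDiffOn ℝ j g (Set.Ioo α ω) := by
  induction j with
  | zero =>
    simp only [Nat.cast_zero, contDiffOn_zero]
    exact (continuous_of_profile hg).continuousOn
  | succ j ih =>
    have hH : ContDiffOn ℝ j (fun s => truncPow M p (g s)) (Set.Ioo α ω) :=
      (ih.rpow_const_of_ne (p := p) fun s hs => (hI s hs).1.ne').congr fun s hs =>
        truncPow_of_mem (hI s hs).1.le (hI s hs).2.le
    push_cast
    rw [contDiffOn_succ_iff_deriv_of_isOpen isOpen_Ioo]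
    refine ⟨fun s _ => (hg s).differentiableAt.differentiableWithinAt, by simp, ?_⟩
    refine ContDiffOn.congr (f := profileRHS (truncPow M p) k k₁ k₂ g) ?_ fun s _ => (hg s).deriv
    exact (contDiffOn_const.mul hH).add
      (contDiffOn_const.mul (contDiffOn_radialAvg hα hω j k _ hH))

lemma profile_second_order {α ω : ℝ} (hα : α < 0) (hω : 0 < ω)
    (hg : ∀ s, HasDerivAt g (profileRHS (truncPow M p) k k₁ k₂ g s) s)
    (hI : ∀ s ∈ Set.Ioo α ω, 0 < g s ∧ g s < M) {s : ℝ} (hs : s ∈ Set.Ioo α ω) :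
    HasDerivAt (deriv g) (deriv (deriv g) s) s ∧
    2 * s * deriv (deriv g) s + (k + 1) * deriv g s
      = 2 * s * k₁ * (p * g s ^ (p - 1) * deriv g s) + (k₂ + (k + 1) * k₁) * g s ^ p := by
  have hc1 := contDiffOn_profile hα hω hg hI 1
  have hdc : ContinuousOn (deriv g) (Set.Ioo α ω) :=
    hc1.continuousOn_deriv_of_isOpen isOpen_Ioo (by simp)
  have hG : ∀ t ∈ Set.Ioo α ω,
      HasDerivAt (fun t => truncPow M p (g t)) (p * g t ^ (p - 1) * deriv g t) t := by
    intro t ht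
    have h1 := (hg t).differentiableAt.hasDerivAt.rpow_const (p := p) (Or.inl (hI t ht).1.ne')
    refine (h1.congr_of_eventuallyEq ?_).congr_deriv (by ring)
    filter_upwards [isOpen_Ioo.mem_nhds ht] with x hx
    exact truncPow_of_mem (hI x hx).1.le (hI x hx).2.le
  have hG' : ContinuousOn (fun t => p * g t ^ (p - 1) * deriv g t) (Set.Ioo α ω) := by
    refine ContinuousOn.mul (ContinuousOn.mul continuousOn_const ?_) hdc
    exact hc1.continuousOn.rpow_const fun t ht => Or.inl (hI t ht).1.ne'
  have h2 : HasDerivAt (deriv g) (k₁ * (p * g s ^ (p - 1) * deriv g s) +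
      k₂ * radialAvg (k + 2) (fun t => p * g t ^ (p - 1) * deriv g t) s) s := by
    have : deriv g = profileRHS (truncPow M p) k k₁ k₂ g := funext fun s => (hg s).deriv
    refine HasDerivAt.congr_of_eventuallyEq ?_ (Filter.Eventually.of_forall (congrFun this))
    exact ((hG s hs).const_mul k₁).add ((hasDerivAt_radialAvg k hα hω hG hG' hs).const_mul k₂)
  have h3 := mul_radialAvg_deriv k hα hω hG hG' hs
  have h4 := (hg s).deriv
  rw [h2.deriv]
  refine ⟨h2, ?_⟩
  rw [profileRHS] at h4
  simp only [truncPow_of_mem (hI s hs).1.le (hI s hs).2.le] at h3 h4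
  linear_combination k₂ * h3 + (k + 1) * h4

end Profile

section Energy

variable {N p b d e : ℝ} {g : ℝ → ℝ}

lemma hasDerivAt_radial_energy {s g₂ : ℝ} (hp : 1 < p) (hs0 : 0 < g s)
    (hg : DifferentiableAt ℝ g s) (hg₂ : HasDerivAt (deriv g) g₂ s)
    (hode : 4 * s * g₂ + 2 * N * deriv g s
      = -(2 * b * s * (p * g s ^ (p - 1) * deriv g s)) - e * g s ^ p) :
    HasDerivAt (fun s => 2 * s * deriv g s ^ 2 + e / (p + 1) * g s ^ (p + 1))
      (-((2 * N - 2 + 2 * b * s * p * g s ^ (p - 1)) * deriv g s ^ 2)) s := by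
  have h1 := hg.hasDerivAt.rpow_const (p := p + 1) (Or.inl hs0.ne')
  have h2 := (((hasDerivAt_id s).const_mul 2).mul (hg₂.pow 2)).add (h1.const_mul (e / (p + 1)))
  refine h2.congr_deriv ?_
  have hp1 : p + 1 ≠ 0 := by linarith
  have e1 : e / (p + 1) * (deriv g s * (p + 1) * g s ^ p) = e * deriv g s * g s ^ p := by
    field_simp
  rw [add_sub_cancel_right, e1]
  simp only [id, Pi.pow_apply]
  push_cast
  linear_combination deriv g s * hode

lemma hasDerivAt_cylinder_energy {s g₂ : ℝ} (hN : 2 < N) (hp : p = (N + 2) / (N - 2))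
    (he : e = (2 * b + d) * (N + 2) / 4) (hs : 0 < s) (hs0 : 0 < g s)
    (hg : DifferentiableAt ℝ g s) (hg₂ : HasDerivAt (deriv g) g₂ s)
    (hode : 4 * s * g₂ + 2 * N * deriv g s
      = -(2 * b * s * (p * g s ^ (p - 1) * deriv g s)) - e * g s ^ p) :
    HasDerivAt (fun s => s ^ (N / 2) * (2 * s * deriv g s ^ 2 + (N - 2) * (g s * deriv g s)
        + d * (N ^ 2 - 4) / (8 * N) * g s ^ (p + 1)))
      (-(2 * b * p * s ^ (N / 2 - 1) * g s ^ (p - 1) * (s * deriv g s + (N - 2) / 4 * g s) ^ 2))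
      s := by
  have h1 := hg.hasDerivAt.rpow_const (p := p + 1) (Or.inl hs0.ne')
  have h2 := ((((hasDerivAt_id s).const_mul 2).mul (hg₂.pow 2)).add
    ((hg.hasDerivAt.mul hg₂).const_mul (N - 2))).add (h1.const_mul (d * (N ^ 2 - 4) / (8 * N)))
  have h3 := (Real.hasDerivAt_rpow_const (p := N / 2) (Or.inl hs.ne')).mul h2
  refine h3.congr_deriv ?_
  have hs' : s ^ (N / 2) = s * s ^ (N / 2 - 1) := by
    rw [Real.rpow_sub_one hs.ne']; field_simp
  have hg1 : g s ^ p = g s * g s ^ (p - 1) := by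
    rw [Real.rpow_sub_one hs0.ne']; field_simp
  have hg2 : g s ^ (p + 1) = g s * (g s * g s ^ (p - 1)) := by
    rw [Real.rpow_add_one hs0.ne', hg1]; ring
  rw [hg1] at hode
  simp only [id, Pi.add_apply, Pi.mul_apply, Pi.pow_apply, add_sub_cancel_right]
  rw [hs', hg2, hg1]
  generalize g s ^ (p - 1) = X at *
  generalize s ^ (N / 2 - 1) = Y at *
  generalize deriv g s = v at *
  generalize g s = w at *
  have hN2 : N - 2 ≠ 0 := by linarith
  have hN0 : N ≠ 0 := by linarith
  have key : 4 * s * g₂ = -(2 * b * s * (p * X * v)) - e * (w * X) - 2 * N * v := by linarith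
  subst hp he
  have : g₂ = (-(2 * b * s * ((N + 2) / (N - 2) * X * v))
    - (2 * b + d) * (N + 2) / 4 * (w * X) - 2 * N * v) / (4 * s) := by
    field_simp at key ⊢
    linarith
  rw [this]
  push_cast
  field_simp
  ring

end Energy

section Global

variable {M p b d e a α ω : ℝ} {k : ℕ} {g : ℝ → ℝ}

lemma profile_ode (hα : α < 0) (hω : 0 < ω)
    (hg : ∀ s, HasDerivAt g
      (profileRHS (truncPow M p) k (-b / 2) (-(e - (k + 1) * b) / 2) g s) s)
    (hI : ∀ s ∈ Set.Ioo α ω, 0 < g s ∧ g s < M) {s : ℝ} (hs : s ∈ Set.Ioo α ω) :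
    HasDerivAt (deriv g) (deriv (deriv g) s) s ∧
    4 * s * deriv (deriv g) s + 2 * ((k : ℝ) + 1) * deriv g s
      = -(2 * b * s * (p * g s ^ (p - 1) * deriv g s)) - e * g s ^ p := by
  obtain ⟨h1, h2⟩ := profile_second_order hα hω hg hI hs
  exact ⟨h1, by linear_combination 2 * h2⟩

lemma profile_le (ha : 0 ≤ a) (hp : 1 < p) (hb : 0 ≤ b) (he : 0 < e) (hα : α < 0) (hω : 0 < ω)
    (hg0 : g 0 = a)
    (hg : ∀ s, HasDerivAt g
      (profileRHS (truncPow M p) k (-b / 2) (-(e - (k + 1) * b) / 2) g s) s)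
    (hI : ∀ s ∈ Set.Ioo α ω, 0 < g s ∧ g s < M) (hgω : 0 ≤ g ω) : g ω ≤ a := by
  have hgc := continuous_of_profile hg
  have hdc := continuous_deriv_of_profile (by linarith) hg
  have hd : ∀ s ∈ Set.Ioo 0 ω, HasDerivAt
      (fun s => 2 * s * deriv g s ^ 2 + e / (p + 1) * g s ^ (p + 1))
      (-((2 * ((k : ℝ) + 1) - 2 + 2 * b * s * p * g s ^ (p - 1)) * deriv g s ^ 2)) s := by
    intro s hs
    have hs' : s ∈ Set.Ioo α ω := ⟨hα.trans hs.1, hs.2⟩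
    obtain ⟨h1, h2⟩ := profile_ode hα hω hg hI hs'
    exact hasDerivAt_radial_energy hp (hI s hs').1 (hg s).differentiableAt h1 h2
  have hanti : AntitoneOn (fun s => 2 * s * deriv g s ^ 2 + e / (p + 1) * g s ^ (p + 1))
      (Set.Icc 0 ω) := by
    apply antitoneOn_of_deriv_nonpos (convex_Icc 0 ω)
    · apply Continuous.continuousOn
      have : Continuous fun s => g s ^ (p + 1) :=
        hgc.rpow_const fun _ => Or.inr (by linarith)
      fun_prop
    · intro s hs
      rw [interior_Icc] at hs
      exact (hd s hs).differentiableAt.differentiableWithinAt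
    · intro s hs
      rw [interior_Icc] at hs
      rw [(hd s hs).deriv]
      have h1 : 0 ≤ g s ^ (p - 1) := Real.rpow_nonneg (hI s ⟨hα.trans hs.1, hs.2⟩).1.le _
      have h2 : 0 ≤ b * s * p * g s ^ (p - 1) := by
        have := hs.1
        positivity
      have h3 : (0 : ℝ) ≤ k := Nat.cast_nonneg k
      have h4 : 0 ≤ (2 * ((k : ℝ) + 1) - 2 + 2 * b * s * p * g s ^ (p - 1)) * deriv g s ^ 2 :=
        mul_nonneg (by nlinarith) (sq_nonneg _)
      linarith
  have h1 := hanti (Set.left_mem_Icc.2 hω.le) (Set.right_mem_Icc.2 hω.le) hω.le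
  simp only [hg0] at h1
  have h2 : 0 ≤ 2 * ω * deriv g ω ^ 2 := by positivity
  have h3 : e / (p + 1) * g ω ^ (p + 1) ≤ e / (p + 1) * a ^ (p + 1) := by linarith
  have h4 : g ω ^ (p + 1) ≤ a ^ (p + 1) := le_of_mul_le_mul_left h3 (by positivity)
  exact (Real.rpow_le_rpow_iff hgω ha (by linarith)).1 h4

/-- The energy of a radial profile in logarithmic cylindrical coordinates. -/
def cylinderEnergy (N p d : ℝ) (g : ℝ → ℝ) (s : ℝ) : ℝ :=
  s ^ (N / 2) * (2 * s * deriv g s ^ 2 + (N - 2) * (g s * deriv g s)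
    + d * (N ^ 2 - 4) / (8 * N) * g s ^ (p + 1))

lemma hasDerivAt_cylinderEnergy_profile (hk : 2 ≤ k)
    (hp : p = ((k : ℝ) + 1 + 2) / ((k : ℝ) + 1 - 2))
    (he : e = (2 * b + d) * ((k : ℝ) + 1 + 2) / 4) (hα : α < 0) (hω : 0 < ω)
    (hg : ∀ s, HasDerivAt g
      (profileRHS (truncPow M p) k (-b / 2) (-(e - (k + 1) * b) / 2) g s) s)
    (hI : ∀ s ∈ Set.Ioo α ω, 0 < g s ∧ g s < M) {s : ℝ} (hs : s ∈ Set.Ioo 0 ω) :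
    HasDerivAt (cylinderEnergy (k + 1) p d g)
      (-(2 * b * p * s ^ (((k : ℝ) + 1) / 2 - 1) * g s ^ (p - 1)
        * (s * deriv g s + ((k : ℝ) + 1 - 2) / 4 * g s) ^ 2)) s := by
  have hs' : s ∈ Set.Ioo α ω := ⟨hα.trans hs.1, hs.2⟩
  obtain ⟨h1, h2⟩ := profile_ode hα hω hg hI hs'
  have hk' : (2 : ℝ) ≤ k := by exact_mod_cast hk
  exact hasDerivAt_cylinder_energy (by linarith) hp he hs.1 (hI s hs').1 (hg s).differentiableAt h1 h2

lemma antitoneOn_cylinderEnergy_profile (hk : 2 ≤ k)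
    (hp : p = ((k : ℝ) + 1 + 2) / ((k : ℝ) + 1 - 2)) (hb : 0 ≤ b)
    (he : e = (2 * b + d) * ((k : ℝ) + 1 + 2) / 4) (hα : α < 0) (hω : 0 < ω)
    (hg : ∀ s, HasDerivAt g
      (profileRHS (truncPow M p) k (-b / 2) (-(e - (k + 1) * b) / 2) g s) s)
    (hI : ∀ s ∈ Set.Ioo α ω, 0 < g s ∧ g s < M) :
    AntitoneOn (cylinderEnergy (k + 1) p d g) (Set.Icc 0 ω) := by
  have hk' : (2 : ℝ) ≤ k := by exact_mod_cast hk
  have hp0 : 0 < p := by rw [hp]; apply div_pos <;> linarith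
  have hgc := continuous_of_profile hg
  have hdc := continuous_deriv_of_profile hp0.le hg
  have hd := fun s (hs : s ∈ Set.Ioo 0 ω) =>
    hasDerivAt_cylinderEnergy_profile hk hp he hα hω hg hI hs
  apply antitoneOn_of_deriv_nonpos (convex_Icc 0 ω)
  · apply Continuous.continuousOn
    have h1 : Continuous fun s => g s ^ (p + 1) := hgc.rpow_const fun _ => Or.inr (by linarith)
    have h2 : Continuous fun s : ℝ => s ^ (((k : ℝ) + 1) / 2) :=
      continuous_id.rpow_const fun _ => Or.inr (by positivity)
    unfold cylinderEnergy
    fun_prop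
  · intro s hs
    rw [interior_Icc] at hs
    exact (hd s hs).differentiableAt.differentiableWithinAt
  · intro s hs
    rw [interior_Icc] at hs
    rw [(hd s hs).deriv]
    have h1 : 0 ≤ g s ^ (p - 1) := Real.rpow_nonneg (hI s ⟨hα.trans hs.1, hs.2⟩).1.le _
    have h2 : 0 ≤ s ^ (((k : ℝ) + 1) / 2 - 1) := Real.rpow_nonneg hs.1.le _
    have h3 : 0 ≤ 2 * b * p * s ^ (((k : ℝ) + 1) / 2 - 1) * g s ^ (p - 1)
        * (s * deriv g s + ((k : ℝ) + 1 - 2) / 4 * g s) ^ 2 := by positivity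
    linarith

lemma cylinderEnergy_zero {N : ℝ} (hN : 0 < N) : cylinderEnergy N p d g 0 = 0 := by
  rw [cylinderEnergy, Real.zero_rpow (by positivity), zero_mul]

lemma profile_pos (ha : 0 < a) (hk : 2 ≤ k)
    (hp : p = ((k : ℝ) + 1 + 2) / ((k : ℝ) + 1 - 2)) (hb : 0 < b)
    (he : e = (2 * b + d) * ((k : ℝ) + 1 + 2) / 4) (hα : α < 0) (hω : 0 < ω) (hg0 : g 0 = a)
    (hg : ∀ s, HasDerivAt g
      (profileRHS (truncPow M p) k (-b / 2) (-(e - (k + 1) * b) / 2) g s) s)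
    (hI : ∀ s ∈ Set.Ioo α ω, 0 < g s ∧ g s < M) (hgω : 0 ≤ g ω) : 0 < g ω := by
  refine hgω.lt_of_ne fun hz => ?_
  have hk' : (2 : ℝ) ≤ k := by exact_mod_cast hk
  have hp0 : 0 < p := by rw [hp]; apply div_pos <;> linarith
  have hanti := antitoneOn_cylinderEnergy_profile hk hp hb.le he hα hω hg hI
  have hE0 : cylinderEnergy (k + 1) p d g 0 = 0 := cylinderEnergy_zero (by positivity)
  have hEω : 0 ≤ cylinderEnergy (k + 1) p d g ω := by
    rw [cylinderEnergy, ← hz, Real.zero_rpow (by linarith)]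
    have := Real.rpow_nonneg hω.le (((k : ℝ) + 1) / 2)
    simp only [zero_mul, mul_zero, add_zero]
    positivity
  have hE : ∀ s ∈ Set.Ioo 0 ω, cylinderEnergy (k + 1) p d g s = 0 := by
    intro s hs
    have hs' := Set.Ioo_subset_Icc_self hs
    have h1 := hanti (Set.left_mem_Icc.2 hω.le) hs' hs.1.le
    have h2 := hanti hs' (Set.right_mem_Icc.2 hω.le) hs.2.le
    linarith
  have hzero : ∀ s ∈ Set.Ioo 0 ω, s * deriv g s + ((k : ℝ) + 1 - 2) / 4 * g s = 0 := by
    intro s hs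
    have h1 := hasDerivAt_cylinderEnergy_profile hk hp he hα hω hg hI hs
    have h2 : HasDerivAt (cylinderEnergy (k + 1) p d g) 0 s := by
      refine (hasDerivAt_const s (0 : ℝ)).congr_of_eventuallyEq ?_
      filter_upwards [isOpen_Ioo.mem_nhds hs] with x hx
      exact hE x hx
    have h3 := h1.unique h2
    have h4 : 0 < g s ^ (p - 1) := Real.rpow_pos_of_pos (hI s ⟨hα.trans hs.1, hs.2⟩).1 _
    have h5 : 0 < s ^ (((k : ℝ) + 1) / 2 - 1) := Real.rpow_pos_of_pos hs.1 _
    have h6 : 0 < 2 * b * p * s ^ (((k : ℝ) + 1) / 2 - 1) * g s ^ (p - 1) := by positivity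
    rw [neg_eq_zero] at h3
    exact pow_eq_zero_iff two_ne_zero |>.1 ((mul_eq_zero.1 h3).resolve_left h6.ne')
  have hcont : Continuous fun s => s * deriv g s + ((k : ℝ) + 1 - 2) / 4 * g s := by
    have hgc := continuous_of_profile hg
    have hdc := continuous_deriv_of_profile hp0.le hg
    fun_prop
  have hcl : IsClosed {s | s * deriv g s + ((k : ℝ) + 1 - 2) / 4 * g s = 0} :=
    isClosed_eq hcont continuous_const
  have h0 : (0 : ℝ) ∈ closure (Set.Ioo 0 ω) := by
    rw [closure_Ioo hω.ne]
    exact Set.left_mem_Icc.2 hω.le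
  have h1 : (0 : ℝ) * deriv g 0 + ((k : ℝ) + 1 - 2) / 4 * g 0 = 0 :=
    closure_minimal (s := Set.Ioo 0 ω) hzero hcl h0
  rw [hg0] at h1
  have : 0 < ((k : ℝ) + 1 - 2) / 4 * a := mul_pos (by linarith) ha
  linarith

lemma exists_profile_mem_Ioo (ha : 0 < a) (haM : a < M) (hk : 2 ≤ k)
    (hp : p = ((k : ℝ) + 1 + 2) / ((k : ℝ) + 1 - 2)) (hb : 0 < b) (hd : 0 < d)
    (he : e = (2 * b + d) * ((k : ℝ) + 1 + 2) / 4) (hg0 : g 0 = a)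
    (hg : ∀ s, HasDerivAt g
      (profileRHS (truncPow M p) k (-b / 2) (-(e - (k + 1) * b) / 2) g s) s) :
    ∃ α < 0, ∀ s, α < s → 0 < g s ∧ g s < M := by
  have hk' : (2 : ℝ) ≤ k := by exact_mod_cast hk
  have hp1 : 1 < p := by rw [hp, lt_div_iff₀] <;> linarith
  have he0 : 0 < e := by rw [he]; positivity
  have hgc := continuous_of_profile hg
  have hopen : IsOpen (g ⁻¹' Set.Ioo 0 M) := isOpen_Ioo.preimage hgc
  obtain ⟨ε, hε, hball⟩ := Metric.isOpen_iff.1 hopen 0 (by simp [hg0, ha, haM])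
  have hnear : ∀ s, -ε < s → s ≤ 0 → s ∈ g ⁻¹' Set.Ioo 0 M := fun s h1 h2 => hball (by
    rw [Metric.mem_ball, Real.dist_eq, sub_zero, abs_lt]; constructor <;> linarith)
  refine ⟨-ε, by linarith, ?_⟩
  suffices h : ∀ s, 0 ≤ s → s ∈ g ⁻¹' Set.Ioo 0 M by
    intro s hs
    rcases le_total s 0 with h0 | h0
    · exact hnear s hs h0
    · exact h s h0
  by_contra! hcon
  obtain ⟨s₁, hs₁, hs₁'⟩ := hcon
  set S : Set ℝ := Set.Ici 0 ∩ (g ⁻¹' Set.Ioo 0 M)ᶜ with hS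
  have hSc : IsClosed S := isClosed_Ici.inter hopen.isClosed_compl
  have hSb : BddBelow S := ⟨0, fun x hx => hx.1⟩
  have hωS : sInf S ∈ S := hSc.csInf_mem ⟨s₁, hs₁, hs₁'⟩ hSb
  set ω := sInf S with hωdef
  have hω : 0 < ω := by
    refine lt_of_le_of_ne hωS.1 fun h0 => hωS.2 ?_
    rw [← h0]
    exact hnear 0 (by linarith) le_rfl
  have hI : ∀ s ∈ Set.Ioo (-ε) ω, 0 < g s ∧ g s < M := by
    intro s hs
    rcases le_total s 0 with h0 | h0
    · exact hnear s hs.1 h0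
    · by_contra hn
      exact absurd (csInf_le hSb (show s ∈ S from ⟨h0, hn⟩)) (not_le.2 hs.2)
  have hgω : 0 ≤ g ω := by
    have hcl : IsClosed {s | 0 ≤ g s} := isClosed_le continuous_const hgc
    refine closure_minimal (s := Set.Ioo (-ε) ω) (fun s hs => (hI s hs).1.le) hcl ?_
    rw [closure_Ioo (by linarith)]
    exact Set.right_mem_Icc.2 (by linarith)
  have h1 := profile_le ha.le hp1 hb.le he0 (by linarith) hω hg0 hg hI hgω
  have h2 := profile_pos ha hk hp hb he (by linarith) hω hg0 hg hI hgω
  exact hωS.2 ⟨h2, h1.trans_lt haM⟩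

lemma profile_decay (hk : 2 ≤ k)
    (hp : p = ((k : ℝ) + 1 + 2) / ((k : ℝ) + 1 - 2)) (hb : 0 ≤ b) (hd : 0 < d)
    (he : e = (2 * b + d) * ((k : ℝ) + 1 + 2) / 4) (hα : α < 0)
    (hg : ∀ s, HasDerivAt g
      (profileRHS (truncPow M p) k (-b / 2) (-(e - (k + 1) * b) / 2) g s) s)
    (hI : ∀ s, α < s → 0 < g s ∧ g s < M) :
    ∃ C > 0, ∀ s, 0 < s → g s ^ (p - 1) ≤ C / s := by
  have hk' : (2 : ℝ) ≤ k := by exact_mod_cast hk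
  refine ⟨((k : ℝ) + 1 - 2) ^ 2 / 8 / (d * (((k : ℝ) + 1) ^ 2 - 4) / (8 * ((k : ℝ) + 1))), ?_, ?_⟩
  · have : 0 < (k : ℝ) + 1 - 2 := by linarith
    have : 0 < ((k : ℝ) + 1) ^ 2 - 4 := by nlinarith
    positivity
  intro s hs
  have hanti := antitoneOn_cylinderEnergy_profile hk hp hb he hα hs hg
    (fun t ht => hI t ht.1)
  have h1 := hanti (Set.left_mem_Icc.2 hs.le) (Set.right_mem_Icc.2 hs.le) hs.le
  rw [cylinderEnergy_zero (by positivity), cylinderEnergy] at h1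
  have h2 := nonpos_of_mul_nonpos_right h1 (Real.rpow_pos_of_pos hs _)
  have hg0 := (hI s (hα.trans hs)).1
  have hgp : g s ^ (p + 1) = g s ^ 2 * g s ^ (p - 1) := by
    rw [← Real.rpow_natCast, ← Real.rpow_add hg0]
    congr 1
    push_cast
    ring
  rw [hgp] at h2
  have hB : 0 < d * (((k : ℝ) + 1) ^ 2 - 4) / (8 * ((k : ℝ) + 1)) := by
    have : 0 < ((k : ℝ) + 1) ^ 2 - 4 := by nlinarith
    positivity
  generalize d * (((k : ℝ) + 1) ^ 2 - 4) / (8 * ((k : ℝ) + 1)) = B at *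
  generalize g s ^ (p - 1) = X at *
  generalize deriv g s = v at *
  generalize g s = w at *
  generalize (k : ℝ) + 1 - 2 = q at *
  rw [div_div, div_div, le_div_iff₀ (by positivity)]
  have h3 : w ^ 2 * (X * (8 * (B * s))) ≤ w ^ 2 * q ^ 2 := by
    nlinarith [sq_nonneg (4 * s * v + q * w)]
  exact le_of_mul_le_mul_left h3 (by positivity)

end Global

section Radial

variable {n : ℕ} {f f₁ : ℝ → ℝ} {f₂ : ℝ}

lemma hasFDerivAt_comp_norm_sq {x : Euc n} {c : ℝ} (hf : HasDerivAt f c (‖x‖ ^ 2)) :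
    HasFDerivAt (fun y : Euc n => f (‖y‖ ^ 2)) ((2 * c) • innerSL ℝ x) x := by
  have h1 : HasFDerivAt (fun y : Euc n => ‖y‖ ^ 2) (2 • innerSL ℝ x) x :=
    (hasStrictFDerivAt_norm_sq x).hasFDerivAt
  refine (hf.comp_hasFDerivAt x h1).congr_fderiv ?_
  ext v
  simp
  ring

lemma inner_gradient_comp_norm_sq {x : Euc n} {c : ℝ} (hf : HasDerivAt f c (‖x‖ ^ 2)) :
    ⟪x, gradient (fun y : Euc n => f (‖y‖ ^ 2)) x⟫ = 2 * ‖x‖ ^ 2 * c := by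
  rw [real_inner_comm, gradient, InnerProductSpace.toDual_symm_apply,
    (hasFDerivAt_comp_norm_sq hf).fderiv]
  simp
  ring

lemma lap_comp_norm_sq {x : Euc n} (hf : ∀ s, 0 ≤ s → HasDerivAt f (f₁ s) s)
    (hf₁ : HasDerivAt f₁ f₂ (‖x‖ ^ 2)) :
    lap (fun y : Euc n => f (‖y‖ ^ 2)) x = 4 * ‖x‖ ^ 2 * f₂ + 2 * n * f₁ (‖x‖ ^ 2) := by
  have h1 : ∀ i : Fin n, (fun y : Euc n => fderiv ℝ (fun y : Euc n => f (‖y‖ ^ 2)) y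
      (EuclideanSpace.single i 1)) = fun y => 2 * f₁ (‖y‖ ^ 2) * y i := by
    intro i
    funext y
    rw [(hasFDerivAt_comp_norm_sq (hf _ (sq_nonneg ‖y‖))).fderiv]
    simp [EuclideanSpace.inner_single_right]
  have h2 : ∀ i : Fin n, fderiv ℝ (fun y : Euc n => 2 * f₁ (‖y‖ ^ 2) * y i) x
      (EuclideanSpace.single i 1) = 4 * f₂ * x i ^ 2 + 2 * f₁ (‖x‖ ^ 2) := by
    intro i
    have h3 : HasFDerivAt (fun y : Euc n => y i) (EuclideanSpace.proj (𝕜 := ℝ) i) x :=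
      (EuclideanSpace.proj (𝕜 := ℝ) i).hasFDerivAt
    have h4 := ((hasFDerivAt_comp_norm_sq hf₁).const_mul 2).mul h3
    refine (DFunLike.congr_fun h4.fderiv _).trans ?_
    simp [EuclideanSpace.inner_single_right]
    ring
  simp only [lap, h1, h2]
  rw [Finset.sum_add_distrib, ← Finset.mul_sum, EuclideanSpace.norm_sq_eq]
  simp
  ring

end Radial

/-- existence of the cigar Yamabe shrinkers, of slow-decay rate at infinity. -/
theorem cigars_exist (n : ℕ) (hn : 3 ≤ n)
    (m β γ : ℝ)
    (hm : m = ((n : ℝ) - 2) / ((n : ℝ) + 2))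
    (hβ : 0 < β)
    (hγ : γ = (2 * β + 1) / (1 - m)) :
    ∀ lam : ℝ, 0 < lam →
      ∃ u : Euc n → ℝ, (∀ x, 0 < u x) ∧ ContDiff ℝ (⊤ : ℕ∞) u ∧ IsRadial u ∧
        u 0 = lam ∧ YamabePDE m β γ u ∧
        ∃ C : ℝ, 0 < C ∧
          ∀ x : Euc n, 1 ≤ ‖x‖ → u x ≤ C * ‖x‖ ^ (-(2 / (1 - m))) := by
  intro lam hlam
  obtain ⟨k, rfl⟩ : ∃ k, n = k + 1 := ⟨n - 1, by omega⟩
  have hk : 2 ≤ k := by omega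
  have hk' : (2 : ℝ) ≤ k := by exact_mod_cast hk
  push_cast at hm
  have hk1 : 0 < (k : ℝ) + 1 - 2 := by linarith
  have hk3 : 0 < (k : ℝ) + 1 + 2 := by linarith
  have hm0 : 0 < m := by rw [hm]; positivity
  have h1m : 1 - m = 4 / ((k : ℝ) + 1 + 2) := by rw [hm]; field_simp; ring
  set p : ℝ := ((k : ℝ) + 1 + 2) / ((k : ℝ) + 1 - 2) with hp
  have hpm : p * m = 1 := by rw [hp, hm]; field_simp
  have hp1 : 1 < p := by rw [hp, lt_div_iff₀] <;> linarith
  set b : ℝ := β * m / k with hb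
  set d : ℝ := m / k with hd
  set e : ℝ := (2 * b + d) * ((k : ℝ) + 1 + 2) / 4 with he
  have hb0 : 0 < b := by positivity
  have hd0 : 0 < d := by positivity
  set a : ℝ := lam ^ m with ha
  have ha0 : 0 < a := Real.rpow_pos_of_pos hlam m
  have hM0 : 0 ≤ a + 1 := by linarith
  obtain ⟨g, hg0, hg⟩ := exists_profile (continuous_truncPow (M := a + 1) (p := p) (by linarith))
    (mul_nonneg (by linarith) (Real.rpow_nonneg hM0 _)) (abs_truncPow_sub_le hM0 hp1.le)
    (abs_truncPow_le hM0 (by linarith)) k (-b / 2) (-(e - (k + 1) * b) / 2) a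
  obtain ⟨α, hα, hI⟩ := exists_profile_mem_Ioo ha0 (lt_add_one a) hk hp hb0 hd0 he hg0 hg
  obtain ⟨C, hC0, hC⟩ := profile_decay hk hp hb0.le hd0 he hα hg hI
  have hgpos : ∀ s, 0 ≤ s → 0 < g s := fun s hs => (hI s (hα.trans_le hs)).1
  have hgx : ∀ x : Euc (k + 1), 0 < g (‖x‖ ^ 2) := fun x => hgpos _ (sq_nonneg _)
  refine ⟨fun x => g (‖x‖ ^ 2) ^ p, fun x => Real.rpow_pos_of_pos (hgx x) _, ?_, ?_, ?_, ?_, ?_⟩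
  · rw [contDiff_infty]
    intro j
    rw [contDiff_iff_contDiffAt]
    intro x
    have hx : 0 ≤ ‖x‖ ^ 2 := sq_nonneg _
    have h1 : ContDiffAt ℝ j g (‖x‖ ^ 2) :=
      (contDiffOn_profile hα (by linarith : 0 < ‖x‖ ^ 2 + 1) hg (fun s hs => hI s hs.1) j).contDiffAt
        (isOpen_Ioo.mem_nhds ⟨by linarith, by linarith⟩)
    exact (h1.comp x (contDiff_norm_sq ℝ).contDiffAt).rpow_const_of_ne (hgx x).ne'
  · intro x y hxy
    simp only [hxy]
  · simp only [norm_zero, ne_eq, OfNat.ofNat_ne_zero, not_false_eq_true, zero_pow, hg0, ha]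
    rw [← Real.rpow_mul hlam.le, mul_comm, hpm, Real.rpow_one]
  · intro x
    have hx : 0 ≤ ‖x‖ ^ 2 := sq_nonneg _
    obtain ⟨h1, h2⟩ := profile_ode hα (by linarith : 0 < ‖x‖ ^ 2 + 1) hg (fun s hs => hI s hs.1)
      (s := ‖x‖ ^ 2) ⟨by linarith, by linarith⟩
    have hum : (fun y : Euc (k + 1) => (g (‖y‖ ^ 2) ^ p) ^ m) = fun y => g (‖y‖ ^ 2) := by
      funext y
      rw [← Real.rpow_mul (hgx y).le, hpm, Real.rpow_one]
    have h3 := (hg (‖x‖ ^ 2)).differentiableAt.hasDerivAt.rpow_const (p := p) (Or.inl (hgx x).ne')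
    rw [hum, lap_comp_norm_sq (fun s _ => (hg s).differentiableAt.hasDerivAt) h1,
      inner_gradient_comp_norm_sq (f := fun s => g s ^ p) h3]
    push_cast
    have hc : (k : ℝ) / m * b = β := by rw [hb]; field_simp
    have hce : (k : ℝ) / m * e = γ := by
      rw [he, hb, hd, hγ, h1m]; field_simp
    rw [add_sub_cancel_right]
    linear_combination (k : ℝ) / m * h2
      - 2 * ‖x‖ ^ 2 * (p * g (‖x‖ ^ 2) ^ (p - 1) * deriv g (‖x‖ ^ 2)) * hc
      - g (‖x‖ ^ 2) ^ p * hce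
  · refine ⟨C ^ (((k : ℝ) + 1 + 2) / 4), Real.rpow_pos_of_pos hC0 _, fun x hx => ?_⟩
    have hx0 : 0 < ‖x‖ := by linarith
    have hx2 : 0 < ‖x‖ ^ 2 := by positivity
    have hpp : (p - 1) * (((k : ℝ) + 1 + 2) / 4) = p := by rw [hp]; field_simp; ring
    have hexp : -(2 / (1 - m)) = 2 * -(((k : ℝ) + 1 + 2) / 4) := by rw [h1m]; field_simp
    calc g (‖x‖ ^ 2) ^ p = (g (‖x‖ ^ 2) ^ (p - 1)) ^ (((k : ℝ) + 1 + 2) / 4) := by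
          rw [← Real.rpow_mul (hgx x).le, hpp]
      _ ≤ (C / ‖x‖ ^ 2) ^ (((k : ℝ) + 1 + 2) / 4) :=
          Real.rpow_le_rpow (Real.rpow_nonneg (hgx x).le _) (hC _ hx2) (by positivity)
      _ = C ^ (((k : ℝ) + 1 + 2) / 4) * ‖x‖ ^ (-(2 / (1 - m))) := by
          rw [hexp, Real.rpow_mul hx0.le, Real.rpow_ofNat, Real.rpow_neg hx2.le,
            Real.div_rpow hC0.le hx2.le, div_eq_mul_inv]
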